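/- Let [a, b] be a compact real interval and let λ ↦ U(λ) be a norm-continuous family of unitary operators on a complex Hilbert space H such that U(λ) − I is compact for every λ ∈ [a, b]. Then there exist points a = λ₀ < λ₁ < ⋯ < λ_n = b and angles θ₁, …, θ_n ∈ (0, 2π) such that for each i and every λ ∈ [λ_{i−1}, λ_i], the point e^{iθ_i} does not belong to the spectrum of U(λ). -/

import Mathlib

theorem exists_angle_aux {H : Type*} [NormedAddCommGroup H] [InnerProductSpace ℂ H]
    [CompleteSpace H] (U : H →L[ℂ] H) (hU : U ∈ unitary (H →L[ℂ] H))
    (hc : IsCompactOperator ⇑(U - 1)) :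
    ∃ θ ∈ Set.Ioo 0 (2 * Real.pi), Complex.exp ((θ : ℝ) * Complex.I) ∉ spectrum ℂ U := by
  by_contra! hcon
  have hpi := Real.pi_gt_three
  set t : ℕ → ℝ := fun n => Real.pi / 2 + 1 / ((n : ℝ) + 1) with ht
  have ht0 : ∀ n : ℕ, 0 < 1 / ((n : ℝ) + 1) := fun n => by positivity
  have ht1 : ∀ n : ℕ, 1 / ((n : ℝ) + 1) ≤ 1 := fun n => by
    rw [div_le_one (by positivity)]
    have : (0 : ℝ) ≤ n := by positivity
    linarith
  have htinj : Function.Injective t := by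
    intro m n h
    simp only [ht, add_right_inj, one_div, inv_inj, add_left_inj, Nat.cast_inj] at h
    exact h
  set z : ℕ → ℂ := fun n => Complex.exp ((t n : ℝ) * Complex.I) with hz
  have hzre : ∀ n, (z n).re = Real.cos (t n) := fun n => Complex.exp_ofReal_mul_I_re _
  have hznorm : ∀ n, ‖z n‖ = 1 := fun n => Complex.norm_exp_ofReal_mul_I _
  have hzinj : Function.Injective z := by
    intro m n h
    apply htinj
    have h2 := congrArg Complex.re h
    rw [hzre, hzre] at h2
    refine Real.injOn_cos ?_ ?_ h2
    · constructor
      · have := ht0 m; simp only [ht]; linarith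
      · have := ht1 m; simp only [ht]; linarith
    · constructor
      · have := ht0 n; simp only [ht]; linarith
      · have := ht1 n; simp only [ht]; linarith
  have hz1 : ∀ n, 1 ≤ ‖z n - 1‖ := by
    intro n
    have h1 : Real.cos (t n) ≤ 0 := by
      apply Real.cos_nonpos_of_pi_div_two_le_of_le
      · have := ht0 n; simp only [ht]; linarith
      · have := ht1 n; simp only [ht]; linarith
    have h2 := Complex.abs_re_le_norm (z n - 1)
    rw [Complex.sub_re, hzre, Complex.one_re] at h2
    have := neg_abs_le (Real.cos (t n) - 1)
    linarith
  have hev : ∀ n, ∃ v : H, ‖v‖ = 1 ∧ U v = z n • v := by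
    intro n
    have hs : z n ∈ spectrum ℂ U := by
      apply hcon
      constructor
      · have := ht0 n; simp only [ht]; linarith
      · have := ht1 n; simp only [ht]; linarith
    have hs' : z n - 1 ∈ spectrum ℂ (U - 1) := by
      rw [spectrum.mem_iff] at hs ⊢
      convert hs using 2
      rw [map_sub, map_one]; abel
    have hne : z n - 1 ≠ 0 := by
      intro h; have := hz1 n; rw [h, norm_zero] at this; linarith
    have hE := (hc.hasEigenvalue_iff_mem_spectrum hne).2 hs'
    obtain ⟨v, hv⟩ := hE.exists_hasEigenvector
    have hv0 := hv.2
    have hve : (U - 1) v = (z n - 1) • v := hv.apply_eq_smul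
    have hUv : U v = z n • v := by
      simp only [ContinuousLinearMap.sub_apply, ContinuousLinearMap.one_apply, sub_smul,
        one_smul] at hve
      exact sub_left_injective hve
    refine ⟨((‖v‖⁻¹ : ℝ) : ℂ) • v, ?_, ?_⟩
    · rw [norm_smul]
      simp [norm_ne_zero_iff.2 hv0]
    · rw [map_smul, hUv, smul_comm]
  choose v hv1 hvU using hev
  have hinner : ∀ x y : H, inner ℂ (U x) (U y) = inner ℂ x y := by
    intro x y
    rw [← ContinuousLinearMap.adjoint_inner_right, ← ContinuousLinearMap.star_eq_adjoint,
      ← ContinuousLinearMap.mul_apply, (Unitary.mem_iff.1 hU).1, ContinuousLinearMap.one_apply]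
  have horth : ∀ m n, m ≠ n → inner ℂ (v m) (v n) = 0 := by
    intro m n hmn
    have h := hinner (v m) (v n)
    rw [hvU, hvU, inner_smul_left, inner_smul_right, ← mul_assoc] at h
    by_contra h0
    have h1 : (starRingEnd ℂ) (z m) * z n = 1 := by
      apply mul_right_cancel₀ h0
      rw [h, one_mul]
    have h2 : z m * (starRingEnd ℂ) (z m) = 1 := by
      rw [Complex.mul_conj']; simp [hznorm]
    apply hmn
    apply hzinj
    calc z m = z m * ((starRingEnd ℂ) (z m) * z n) := by rw [h1, mul_one]
      _ = z n := by rw [← mul_assoc, h2, one_mul]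
  have hK : ∀ n, (U - 1) (v n) = (z n - 1) • v n := by
    intro n
    simp [hvU, sub_smul]
  have hsep : ∀ m n, m ≠ n → 1 ≤ dist ((U - 1) (v m)) ((U - 1) (v n)) := by
    intro m n hmn
    rw [dist_eq_norm, hK, hK]
    have h0 : inner ℂ ((z m - 1) • v m) ((z n - 1) • v n) = 0 := by
      rw [inner_smul_left, inner_smul_right, horth m n hmn]; simp
    have h3 := @norm_sub_sq ℂ H _ _ _ ((z m - 1) • v m) ((z n - 1) • v n)
    rw [h0, norm_smul, norm_smul, hv1, hv1] at h3
    simp only [map_zero, mul_zero, sub_zero, mul_one] at h3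
    have := hz1 m
    have h5 := norm_nonneg ((z m - 1) • v m - (z n - 1) • v n)
    nlinarith [sq_nonneg ‖z n - 1‖]
  obtain ⟨K, hKc, hKs⟩ := hc.image_closedBall_subset_compact (f := ((U - 1 : H →L[ℂ] H) : H →ₗ[ℂ] H)) 1
  have hmem : ∀ n, (U - 1) (v n) ∈ K := fun n =>
    hKs ⟨v n, by simp [hv1], rfl⟩
  obtain ⟨x, -, φ, hφ, hlim⟩ := hKc.tendsto_subseq hmem
  obtain ⟨N, hN⟩ := Metric.cauchySeq_iff.1 hlim.cauchySeq 1 one_pos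
  have h1 := hN N le_rfl (N + 1) (Nat.le_succ N)
  have h2 := hsep (φ N) (φ (N + 1)) (hφ (Nat.lt_succ_self N)).ne
  exact absurd h1 (not_lt.2 h2)

/-- Let `λ ↦ U λ` be a norm-continuous family of unitary
operators on a complex Hilbert space, for `λ` in a compact interval `[a, b]`,
with `U λ - I` compact for each `λ`. Then there exist points
`a = λ₀ < λ₁ < ⋯ < λₙ = b` and angles `θ₁, …, θₙ ∈ (0, 2π)` such that for each
`i` and every `λ ∈ [λ_{i-1}, λ_i]`, the point `e^{iθ_i}` does not belong to the
spectrum of `U λ`. -/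
theorem exists_partition_with_spectrum_free_angles
    {H : Type*} [NormedAddCommGroup H] [InnerProductSpace ℂ H] [CompleteSpace H]
    (a b : ℝ) (hab : a ≤ b)
    (U : ℝ → (H →L[ℂ] H))
    (hcont : ContinuousOn U (Set.Icc a b))
    (hunit : ∀ l ∈ Set.Icc a b, U l ∈ unitary (H →L[ℂ] H))
    (hcomp : ∀ l ∈ Set.Icc a b, IsCompactOperator ⇑(U l - 1)) :
    ∃ (n : ℕ) (l : Fin (n + 1) → ℝ) (θ : Fin n → ℝ),
      StrictMono l ∧ l 0 = a ∧ l (Fin.last n) = b ∧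
      ∀ i : Fin n, θ i ∈ Set.Ioo 0 (2 * Real.pi) ∧
        ∀ x ∈ Set.Icc (l i.castSucc) (l i.succ),
          Complex.exp (θ i * Complex.I) ∉ spectrum ℂ (U x) := by
  rcases hab.eq_or_lt with rfl | hlt
  · exact ⟨0, fun _ => a, fun _ => 0, (fun i j hij => absurd hij (by omega)), rfl, rfl, fun i => i.elim0⟩
  set V : ℝ → (H →L[ℂ] H) := Set.IccExtend hab ((Set.Icc a b).restrict U) with hV
  have hVc : Continuous V := (continuousOn_iff_continuous_restrict.1 hcont).Icc_extend'
  have hVU : ∀ x ∈ Set.Icc a b, V x = U x := fun x hx => Set.IccExtend_of_mem hab _ hx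
  set c : Set.Ioo 0 (2 * Real.pi) → Set ℝ :=
    fun θ => {x | Complex.exp (((θ : ℝ) : ℂ) * Complex.I) ∉ spectrum ℂ (V x)} with hcdef
  have hopen : ∀ θ, IsOpen (c θ) := by
    intro θ
    have : c θ = (fun x => algebraMap ℂ (H →L[ℂ] H)
        (Complex.exp (((θ : ℝ) : ℂ) * Complex.I)) - V x) ⁻¹' {u | IsUnit u} := by
      ext x
      simp [hcdef, spectrum.mem_iff]
    rw [this]
    exact Units.isOpen.preimage (continuous_const.sub hVc)
  have hcover : Set.Icc a b ⊆ ⋃ θ, c θ := by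
    intro x hx
    obtain ⟨θ, hθ, h⟩ := exists_angle_aux (U x) (hunit x hx) (hcomp x hx)
    refine Set.mem_iUnion.2 ⟨⟨θ, hθ⟩, ?_⟩
    simpa [hcdef, hVU x hx] using h
  obtain ⟨δ, hδ, hL⟩ := lebesgue_number_lemma_of_metric isCompact_Icc hopen hcover
  obtain ⟨N, hN⟩ := exists_nat_gt ((b - a) / δ)
  have hba : 0 < b - a := sub_pos.2 hlt
  have hNpos : (0 : ℝ) < N := lt_trans (div_pos hba hδ) hN
  set s : ℝ := (b - a) / N with hs
  have hspos : 0 < s := div_pos hba hNpos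
  have hsδ : s < δ := by
    rw [hs, div_lt_iff₀ hNpos]
    rw [div_lt_iff₀ hδ] at hN
    linarith
  have hNs : N * s = b - a := by rw [hs]; field_simp
  have hmem : ∀ k : ℕ, k ≤ N → a + k * s ∈ Set.Icc a b := by
    intro k hk
    have hk' : (k : ℝ) ≤ N := by exact_mod_cast hk
    have h1 : (k : ℝ) * s ≤ N * s := by gcongr
    have h2 : 0 ≤ (k : ℝ) * s := by positivity
    constructor <;> linarith
  have hch : ∀ i : Fin N, ∃ θ : Set.Ioo 0 (2 * Real.pi),
      Metric.ball (a + (i : ℕ) * s) δ ⊆ c θ := fun i => hL _ (hmem i i.2.le)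
  choose θ hθ using hch
  refine ⟨N, fun i => a + (i : ℕ) * s, fun i => θ i, ?_, by simp, ?_, ?_⟩
  · intro i j hij
    have : ((i : ℕ) : ℝ) < (j : ℕ) := by exact_mod_cast hij
    have := mul_lt_mul_of_pos_right this hspos
    simpa using this
  · simp only [Fin.val_last]; linarith
  · intro i
    refine ⟨(θ i).2, fun x hx => ?_⟩
    simp only [Fin.val_castSucc, Fin.val_succ, Nat.cast_add, Nat.cast_one] at hx
    have hxab : x ∈ Set.Icc a b := by
      have h1 := hmem i i.2.le
      have h2 := hmem (i + 1) i.2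
      push_cast at h2
      exact ⟨h1.1.trans hx.1, hx.2.trans h2.2⟩
    have hxb : x ∈ Metric.ball (a + (i : ℕ) * s) δ := by
      rw [Metric.mem_ball, Real.dist_eq, abs_lt]
      have := hx.1
      have := hx.2
      constructor <;> linarith
    have := hθ i hxb
    simpa [hcdef, hVU x hxab] using this
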